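/- Let N₁ and N₂ be N-matrices of mixed graphs on finite vertex sets V₁ and V₂ whose underlying graphs are connected, suppose rank N₁ = 2, and suppose N₁ and N₂ have the same characteristic polynomial (in particular |V₁| = |V₂|). Then the two mixed graphs are switching equivalent: there exist a bijection σ : V₁ → V₂ and a function d : V₁ → T₆ such that N₂_{σ(u), σ(v)} = conj(d(u)) · N₁_{u,v} · d(v) for all u, v ∈ V₁. -/

import Mathlib

open Matrix Complex

/-- The sixth root of unity `ω = (1 + i√3)/2`. -/
noncomputable def ω6 : ℂ := (1 + Complex.I * Real.sqrt 3) / 2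

/-- The group `T₆ = {1, -1, ω, ω̄, -ω, -ω̄}` of sixth roots of unity in `ℂ`. -/
noncomputable def T6 : Set ℂ := {1, -1, ω6, star ω6, -ω6, -star ω6}


lemma aux_star_w : star ω6 = 1 - ω6 := by
  have h : star ω6 = (1 - Complex.I * Real.sqrt 3) / 2 := by
    simp [ω6]
    ring
  rw [h, ω6]; ring

lemma aux_w_sq : ω6 ^ 2 = ω6 - 1 := by
  have h3 : ((Real.sqrt 3 : ℝ) : ℂ) ^ 2 = 3 := by
    rw [← Complex.ofReal_pow, Real.sq_sqrt (by norm_num)]; norm_num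
  rw [ω6]
  linear_combination (1/4 : ℂ) * (Complex.I ^ 2) * h3 + (3/4 : ℂ) * Complex.I_sq

lemma aux_mem_T6 (z : ℂ) : z ∈ T6 ↔ z ^ 6 = 1 := by
  have hw := aux_w_sq
  have h3 : ω6 ^ 3 = -1 := by linear_combination (ω6 + 1) * hw
  have h3' : (1 - ω6) ^ 3 = -1 := by linear_combination (-ω6 + 2) * hw
  simp only [T6, Set.mem_insert_iff, Set.mem_singleton_iff, aux_star_w]
  constructor
  · rintro (h | h | h | h | h | h) <;> subst h
    · norm_num
    · norm_num
    · linear_combination (ω6 ^ 3 - 1) * h3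
    · linear_combination ((1 - ω6) ^ 3 - 1) * h3'
    · linear_combination (ω6 ^ 3 - 1) * h3
    · linear_combination ((1 - ω6) ^ 3 - 1) * h3'
  · intro h
    have : (z - 1) * ((z + 1) * ((z - ω6) * ((z - (1 - ω6)) * ((z + ω6) * (z + (1 - ω6)))))) = 0 := by
      have h1 : (z - ω6) * (z - (1 - ω6)) = z ^ 2 - z + 1 := by linear_combination -hw
      have h2 : (z + ω6) * (z + (1 - ω6)) = z ^ 2 + z + 1 := by linear_combination -hw
      calc _ = (z - 1) * (z + 1) * ((z - ω6) * (z - (1 - ω6))) * ((z + ω6) * (z + (1 - ω6))) := by ring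
        _ = z ^ 6 - 1 := by rw [h1, h2]; ring
        _ = 0 := by rw [h]; ring
    simp only [mul_eq_zero] at this
    rcases this with h | h | h | h | h | h
    · left; linear_combination h
    · right; left; linear_combination h
    · right; right; left; linear_combination h
    · right; right; right; left; linear_combination h
    · right; right; right; right; left; linear_combination h
    · right; right; right; right; right; linear_combination h

lemma aux_star_mul {z : ℂ} (h : z ^ 6 = 1) : star z * z = 1 := by
  have := Complex.norm_eq_one_of_pow_eq_one h (by norm_num)
  have h2 := Complex.conj_mul' z
  rw [this] at h2
  simpa using h2

lemma aux_ent {z : ℂ} (h : z ∈ ({0, 1, ω6, star ω6} : Set ℂ)) (h0 : z ≠ 0) :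
    z ^ 6 = 1 := by
  rw [← aux_mem_T6]
  simp only [T6, Set.mem_insert_iff, Set.mem_singleton_iff] at h ⊢
  tauto

/-- No triangle: products of three units have nonzero real part. -/
lemma aux_no_tri {z : ℂ} (h : z ^ 6 = 1) : z + star z ≠ 0 := by
  intro h0
  have h1 := aux_star_mul h
  have h2 : star z = - z := by linear_combination h0
  rw [h2] at h1
  have h3 : z ^ 2 = -1 := by linear_combination -h1
  have h4 : z ^ 6 = -1 := by
    calc z ^ 6 = (z ^ 2) ^ 3 := by ring
      _ = -1 := by rw [h3]; norm_num
  rw [h] at h4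
  norm_num at h4

lemma aux_det {V : Type*} [Fintype V] [DecidableEq V] (N : Matrix V V ℂ)
    (hrank : N.rank = 2) (f g : Fin 3 → V) : (N.submatrix f g).det = 0 := by
  by_contra h
  have h1 := rank_of_det_ne_zero h
  have h2 := rank_submatrix_le N f g
  simp at h1
  omega

lemma aux_struct {V : Type*} [Fintype V] [DecidableEq V]
    (N : Matrix V V ℂ) (hherm : N.IsHermitian)
    (hdiag : ∀ u, N u u = 0)
    (hent : ∀ u v, N u v ∈ ({0, 1, ω6, star ω6} : Set ℂ))
    (G : SimpleGraph V) (hadj : ∀ u v, G.Adj u v ↔ N u v ≠ 0) (hconn : G.Connected)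
    (hrank : N.rank = 2) :
    ∃ (s : V → Bool) (d : V → ℂ), (∀ v, d v ^ 6 = 1) ∧
      ∀ u v, N u v = if s u = s v then 0 else star (d u) * d v := by
  have hs : ∀ u v, star (N u v) = N v u := fun u v => hherm.apply v u
  have hN0 : ∃ u v, N u v ≠ 0 := by
    by_contra! h
    have : N = 0 := by ext i j; exact h i j
    rw [this, rank_zero] at hrank
    omega
  obtain ⟨u, v, huv⟩ := hN0
  have ha := aux_ent (hent u v) huv
  have hvu : N v u ≠ 0 := by rw [← hs u v]; simpa using huv
  have haa : N v u * N u v = 1 := by rw [← hs u v]; exact aux_star_mul ha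
  have key : ∀ w y, N w y = N u v * N v y * N w u + N v u * N u y * N w v := by
    intro w y
    have h := aux_det N hrank ![u, v, w] ![u, v, y]
    rw [det_fin_three] at h
    simp [hdiag] at h
    linear_combination -h - N w y * haa
  have hne : ∀ w, N w u = 0 → N w v = 0 → False := by
    intro w h1 h2
    have : Nontrivial V := ⟨u, v, by rintro rfl; exact huv (hdiag u)⟩
    obtain ⟨y, hy⟩ := hconn.preconnected.exists_adj_of_nontrivial w
    rw [hadj] at hy
    apply hy
    rw [key, h1, h2]; ring
  have htri : ∀ w, N w u ≠ 0 → N w v ≠ 0 → False := by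
    intro w h1 h2
    have h := key w w
    rw [hdiag] at h
    have hvw : N v w ≠ 0 := by rw [← hs w v]; simpa using h2
    have h6 : (N u v * N v w * N w u) ^ 6 = 1 := by
      rw [mul_pow, mul_pow, ha, aux_ent (hent _ _) hvw, aux_ent (hent _ _) h1]; norm_num
    apply aux_no_tri h6
    simp only [star_mul', hs]
    linear_combination -h
  have hsym : ∀ x y, N x y = 0 → N y x = 0 := by
    intro x y h
    rw [← hs x y, h, star_zero]
  have hsym' : ∀ x y, N x y ≠ 0 → N y x ≠ 0 := fun x y h h' => h (hsym _ _ h')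
  classical
  refine ⟨fun w => decide (N w u = 0), fun w => if N w u = 0 then N u v * N v w else N u w, ?_, ?_⟩
  · intro w
    by_cases hw : N w u = 0
    · simp only [hw, if_true]
      rw [mul_pow, ha, aux_ent (hent _ _) (hsym' _ _ (fun h => hne w hw h))]; norm_num
    · simp only [hw, if_false]
      exact aux_ent (hent _ _) (hsym' _ _ hw)
  · intro w y
    by_cases hw : N w u = 0 <;> by_cases hy : N y u = 0
    · simp only [hw, hy, if_true]
      rw [key, hw, hsym y u hy]; ring
    · simp only [hw, hy, if_true, if_false, decide_true, decide_false]
      simp only [star_mul', hs]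
      rw [key w y, hw]; simp; ring
    · simp only [hw, hy, if_true, if_false, decide_true, decide_false]
      simp only [hs]
      rw [key w y, hsym y u hy]; simp; ring
    · simp only [hw, hy, if_true, if_false, decide_false]
      have h1 : N w v = 0 := by by_contra h; exact htri w hw h
      have h2 : N y v = 0 := by by_contra h; exact htri y hy h
      rw [key, h1, hsym y v h2]; ring

lemma aux_trace {V : Type*} [Fintype V] [DecidableEq V] (A : Matrix V V ℂ) (hA : A.IsHermitian) :
    (A * A).trace = ∑ i, ((hA.eigenvalues i : ℂ)) ^ 2 := by
  conv_lhs => rw [hA.spectral_theorem, ← map_mul, Unitary.conjStarAlgAut_apply, trace_mul_comm,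
    ← mul_assoc]
  simp [trace_diagonal, sq]

lemma aux_cospec {V W : Type*} [Fintype V] [DecidableEq V] [Fintype W] [DecidableEq W]
    (A : Matrix V V ℂ) (hA : A.IsHermitian) (B : Matrix W W ℂ) (hB : B.IsHermitian)
    (h : A.charpoly = B.charpoly) :
    Fintype.card V = Fintype.card W ∧ A.rank = B.rank ∧ (A * A).trace = (B * B).trace := by
  have hc : Fintype.card V = Fintype.card W := by
    rw [← charpoly_natDegree_eq_dim A, h, charpoly_natDegree_eq_dim]
  refine ⟨hc, ?_⟩
  let e : W ≃ V := Fintype.equivOfCardEq hc.symm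
  have hB' : (reindex e e B).IsHermitian := by
    rw [reindex_apply]; exact hB.submatrix _
  have hch : A.charpoly = (reindex e e B).charpoly := by rw [charpoly_reindex, h]
  have he := (hA.eigenvalues_eq_eigenvalues_iff hB').2 hch
  constructor
  · rw [← rank_reindex e e B, hA.rank_eq_rank_diagonal, hB'.rank_eq_rank_diagonal, he]
  · have h1 : (reindex e e B * reindex e e B).trace = (B * B).trace := by
      rw [reindex_apply, submatrix_mul_equiv]
      simp only [trace, diag, submatrix_apply]
      exact Equiv.sum_comp e.symm (fun i => (B * B) i i)
    rw [← h1, aux_trace A hA, aux_trace _ hB', he]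

lemma aux_count {V : Type*} [Fintype V] [DecidableEq V] (N : Matrix V V ℂ) (s : V → Bool)
    (d : V → ℂ) (hd : ∀ v, d v ^ 6 = 1)
    (hN : ∀ u v, N u v = if s u = s v then 0 else star (d u) * d v) :
    (N * N).trace = ((2 * (Fintype.card {v // s v = true} * Fintype.card {v // s v = false}) : ℕ) : ℂ) ∧
    Fintype.card {v // s v = true} + Fintype.card {v // s v = false} = Fintype.card V := by
  constructor
  · have h1 : ∀ u v, N u v * N v u = if s u = s v then 0 else 1 := by
      intro u v
      rw [hN u v, hN v u]
      by_cases h : s u = s v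
      · simp [h]
      · rw [if_neg h, if_neg (Ne.symm h), if_neg h]
        linear_combination (star (d v) * d v) * aux_star_mul (hd u) + aux_star_mul (hd v)
    have h2 : ∀ u, ∑ v, (if s u = s v then (0:ℂ) else 1) =
        if s u = true then (Fintype.card {v // s v = false} : ℂ) else (Fintype.card {v // s v = true} : ℂ) := by
      intro u
      cases h : s u
      · simp only [Fintype.card_subtype, ← Finset.sum_boole, if_true, Bool.false_eq_true, if_false]
        apply Finset.sum_congr rfl
        intro v _
        cases s v <;> simp [h]
      · simp only [Fintype.card_subtype, ← Finset.sum_boole, if_true, Bool.false_eq_true, if_false]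
        apply Finset.sum_congr rfl
        intro v _
        cases s v <;> simp [h]
    simp only [trace, diag, mul_apply, h1, h2]
    rw [Finset.sum_ite]
    simp [Fintype.card_subtype]
    ring
  · simp only [Fintype.card_subtype]
    have := Finset.card_filter_add_card_filter_not (s := (Finset.univ : Finset V)) (fun v => s v = true)
    simpa using this

lemma aux_final {V₁ V₂ : Type*} [Fintype V₁] [Fintype V₂]
    (N₁ : Matrix V₁ V₁ ℂ) (N₂ : Matrix V₂ V₂ ℂ) (s₁ : V₁ → Bool) (s₂ : V₂ → Bool)
    (d₁ : V₁ → ℂ) (hd₁ : ∀ v, d₁ v ^ 6 = 1)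
    (hN₁ : ∀ u v, N₁ u v = if s₁ u = s₁ v then 0 else star (d₁ u) * d₁ v)
    (d₂ : V₂ → ℂ) (hd₂ : ∀ v, d₂ v ^ 6 = 1)
    (hN₂ : ∀ u v, N₂ u v = if s₂ u = s₂ v then 0 else star (d₂ u) * d₂ v)
    (hc : ∀ b, Fintype.card {v // s₁ v = b} = Fintype.card {v // s₂ v = b}) :
    ∃ (σ : V₁ ≃ V₂) (d : V₁ → ℂ), (∀ v, d v ∈ T6) ∧
      ∀ u v, N₂ (σ u) (σ v) = star (d u) * N₁ u v * d v := by
  let e : ∀ b, {v // s₁ v = b} ≃ {v // s₂ v = b} := fun b => Fintype.equivOfCardEq (hc b)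
  refine ⟨Equiv.ofFiberEquiv e, fun v => d₂ (Equiv.ofFiberEquiv e v) * star (d₁ v), ?_, ?_⟩
  · intro v
    rw [aux_mem_T6, mul_pow, hd₂, ← star_pow, hd₁]; simp
  · intro u v
    have hm : ∀ w, s₂ (Equiv.ofFiberEquiv e w) = s₁ w := fun w => Equiv.ofFiberEquiv_map e w
    rw [hN₂, hN₁, hm, hm]
    by_cases h : s₁ u = s₁ v
    · simp [h]
    · rw [if_neg h, if_neg h, star_mul', star_star]
      set a := d₂ (Equiv.ofFiberEquiv e u)
      set b := d₂ (Equiv.ofFiberEquiv e v)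
      linear_combination (-(star a * b * (star (d₁ v) * d₁ v))) * aux_star_mul (hd₁ u)
        - star a * b * aux_star_mul (hd₁ v)

/-- A connected mixed graph whose N-matrix has rank `2` is switching
equivalent to every connected mixed graph to which it is cospectral. -/
theorem rank_two_connected_determined_by_spectrum
    {V₁ V₂ : Type*} [Fintype V₁] [DecidableEq V₁] [Fintype V₂] [DecidableEq V₂]
    (N₁ : Matrix V₁ V₁ ℂ) (hherm₁ : N₁.IsHermitian)
    (hdiag₁ : ∀ u, N₁ u u = 0)
    (hent₁ : ∀ u v, N₁ u v ∈ ({0, 1, ω6, star ω6} : Set ℂ))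
    (N₂ : Matrix V₂ V₂ ℂ) (hherm₂ : N₂.IsHermitian)
    (hdiag₂ : ∀ u, N₂ u u = 0)
    (hent₂ : ∀ u v, N₂ u v ∈ ({0, 1, ω6, star ω6} : Set ℂ))
    (G₁ : SimpleGraph V₁) (hadj₁ : ∀ u v, G₁.Adj u v ↔ N₁ u v ≠ 0) (hconn₁ : G₁.Connected)
    (G₂ : SimpleGraph V₂) (hadj₂ : ∀ u v, G₂.Adj u v ↔ N₂ u v ≠ 0) (hconn₂ : G₂.Connected)
    (hrank : N₁.rank = 2)
    (hcospec : N₁.charpoly = N₂.charpoly) :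
    ∃ (σ : V₁ ≃ V₂) (d : V₁ → ℂ), (∀ v, d v ∈ T6) ∧
      ∀ u v, N₂ (σ u) (σ v) = star (d u) * N₁ u v * d v := by
  obtain ⟨hcard, hr, htr⟩ := aux_cospec N₁ hherm₁ N₂ hherm₂ hcospec
  obtain ⟨s₁, d₁, hd₁, hN₁⟩ := aux_struct N₁ hherm₁ hdiag₁ hent₁ G₁ hadj₁ hconn₁ hrank
  obtain ⟨s₂, d₂, hd₂, hN₂⟩ := aux_struct N₂ hherm₂ hdiag₂ hent₂ G₂ hadj₂ hconn₂ (hr ▸ hrank)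
  obtain ⟨ht₁, hc₁⟩ := aux_count N₁ s₁ d₁ hd₁ hN₁
  obtain ⟨ht₂, hc₂⟩ := aux_count N₂ s₂ d₂ hd₂ hN₂
  rw [ht₁, ht₂, Nat.cast_inj] at htr
  have hdich : (Fintype.card {v // s₁ v = true} = Fintype.card {v // s₂ v = true} ∧
      Fintype.card {v // s₁ v = false} = Fintype.card {v // s₂ v = false}) ∨
      (Fintype.card {v // s₁ v = true} = Fintype.card {v // s₂ v = false} ∧
      Fintype.card {v // s₁ v = false} = Fintype.card {v // s₂ v = true}) := by
    generalize Fintype.card {v // s₁ v = true} = p at *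
    generalize Fintype.card {v // s₁ v = false} = q at *
    generalize Fintype.card {v // s₂ v = true} = p' at *
    generalize Fintype.card {v // s₂ v = false} = q' at *
    have hsum : p + q = p' + q' := by omega
    have h : ((p : ℤ) - p') * ((p : ℤ) - q') = 0 := by
      have htr := Nat.eq_of_mul_eq_mul_left (by norm_num) htr
      zify at hsum htr
      linear_combination (p : ℤ) * hsum - htr
    rcases mul_eq_zero.1 h with h | h
    · left; omega
    · right; omega
  rcases hdich with ⟨h1, h2⟩ | ⟨h1, h2⟩
  · apply aux_final N₁ N₂ s₁ s₂ d₁ hd₁ hN₁ d₂ hd₂ hN₂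
    rintro (_ | _)
    · exact h2
    · exact h1
  · refine aux_final N₁ N₂ s₁ (fun v => !(s₂ v)) d₁ hd₁ hN₁ d₂ hd₂ ?_ ?_
    · intro u v
      rw [hN₂]; simp
    · rintro (_ | _)
      · simpa using h2
      · simpa using h1
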